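/- The group Loop(V), defined as the quotient of the free monoid on V × V by the relations (v,u)·(u,r) ~ (v,r) when v, u, r lie on a common affine line and (v,u) ~ empty word when v and u are linearly dependent, is isomorphic to the group PL_0^{cl}(V) of closed piecewise linear loops, via the map sending the generator (v,u) to the triangular loop (v, u−v, −u). -/

import Mathlib

/-!
STATEMENT 8: The group `Loop(V)` (free monoid on `V × V` modulo `(v,u)·(u,r) ~ (v,r)`
for `v,u,r` on a common affine line and `(v,u) ~ ε` for linearly dependent `v,u`) is
isomorphic to the group `PL₀ᶜˡ(V)` of closed piecewise linear loops via
`(v,u) ↦ (v, u−v, −u)`.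
-/

open FreeMonoid

variable (V : Type*) [AddCommGroup V] [Module ℝ V]

/-- The defining relations of `PL₀(V)`. -/
inductive PLRel : FreeMonoid V → FreeMonoid V → Prop
  | pair (v w : V) (h : ¬ LinearIndependent ℝ ![v, w]) :
      PLRel (of v * of w) (of (v + w))
  | zero : PLRel (of (0 : V)) 1

/-- The group (as a quotient monoid) `PL₀(V)` of piecewise linear paths. -/
abbrev PL0 := (conGen (PLRel V)).Quotient

/-- The defining relations of `Loop(V)` on the free monoid over `V × V`. -/
inductive LoopRel : FreeMonoid (V × V) → FreeMonoid (V × V) → Prop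
  | comp (v u r : V) (h : Collinear ℝ ({v, u, r} : Set V)) :
      LoopRel (of (v, u) * of (u, r)) (of (v, r))
  | triv (v u : V) (h : ¬ LinearIndependent ℝ ![v, u]) :
      LoopRel (of (v, u)) 1

/-- The group `Loop(V)` generated by triangular loops. -/
abbrev LoopGrp := (conGen (LoopRel V)).Quotient

variable {V}

/-- The quotient map `FMon(V) → PL₀(V)`. -/
abbrev PLmk : FreeMonoid V →* PL0 V := (conGen (PLRel V)).mk'

/-- The quotient map `FMon(V × V) → Loop(V)`. -/
abbrev Loopmk : FreeMonoid (V × V) →* LoopGrp V := (conGen (LoopRel V)).mk'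

theorem pl_pair (v w : V) (h : ¬ LinearIndependent ℝ ![v, w]) :
    PLmk (of v) * PLmk (of w) = PLmk (of (v + w)) := by
  rw [← map_mul]
  exact (Con.eq _).2 (ConGen.Rel.of _ _ (PLRel.pair v w h))

theorem pl_zero : PLmk (of (0 : V)) = 1 := by
  rw [← map_one (PLmk (V := V))]
  exact (Con.eq _).2 (ConGen.Rel.of _ _ PLRel.zero)

theorem loop_comp (v u r : V) (h : Collinear ℝ ({v, u, r} : Set V)) :
    Loopmk (of (v, u)) * Loopmk (of (u, r)) = Loopmk (of (v, r)) := by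
  rw [← map_mul]
  exact (Con.eq _).2 (ConGen.Rel.of _ _ (LoopRel.comp v u r h))

theorem loop_triv (v u : V) (h : ¬ LinearIndependent ℝ ![v, u]) :
    Loopmk (of (v, u)) = 1 := by
  rw [← map_one (Loopmk (V := V))]
  exact (Con.eq _).2 (ConGen.Rel.of _ _ (LoopRel.triv v u h))

theorem dep_iff (v w : V) : ¬ LinearIndependent ℝ ![v, w] ↔
    ∃ (x : V) (a b : ℝ), v = a • x ∧ w = b • x := by
  constructor
  · intro h
    by_cases hv : v = 0
    · exact ⟨w, 0, 1, by simp [hv], by simp⟩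
    · rw [LinearIndependent.pair_iff' hv] at h
      push Not at h
      obtain ⟨a, ha⟩ := h
      exact ⟨v, 1, a, by simp, ha.symm⟩
  · rintro ⟨x, a, b, rfl, rfl⟩ h
    rw [LinearIndependent.pair_iff] at h
    have h1 := h b (-a) (by module)
    have ha : a = 0 := by linarith [h1.2]
    have h2 := h 1 0 (by simp [ha])
    exact one_ne_zero h2.1

theorem pl_neg_cancel (u : V) : PLmk (of (-u)) * PLmk (of u) = 1 := by
  rw [pl_pair _ _ ((dep_iff _ _).2 ⟨u, -1, 1, by simp, by simp⟩), neg_add_cancel, pl_zero]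

theorem pl_cancel_neg (u : V) : PLmk (of u) * PLmk (of (-u)) = 1 := by
  simpa using pl_neg_cancel (-u)

/-- The triangular loop. -/
def tri (p : V × V) : PL0 V := PLmk (of p.1) * PLmk (of (p.2 - p.1)) * PLmk (of (-p.2))

theorem tri_le : conGen (LoopRel V) ≤ Con.ker (FreeMonoid.lift (tri (V := V))) := by
  refine Con.conGen_le.2 ?_
  rintro _ _ (⟨v, u, r, h⟩ | ⟨v, u, h⟩)
  · rw [Con.ker_rel]
    simp only [map_mul, lift_eval_of, tri]
    have hd : ¬ LinearIndependent ℝ ![u - v, r - u] := by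
      obtain ⟨x, hx⟩ := (collinear_iff_of_mem (p₀ := v) (by simp)).1 h
      obtain ⟨a, ha⟩ := hx u (by simp)
      obtain ⟨b, hb⟩ := hx r (by simp)
      refine (dep_iff _ _).2 ⟨x, a, b - a, ?_, ?_⟩
      · rw [ha]; simp
      · rw [ha, hb]; simp only [vadd_eq_add]; module
    calc PLmk (of v) * PLmk (of (u - v)) * PLmk (of (-u)) *
          (PLmk (of u) * PLmk (of (r - u)) * PLmk (of (-r)))
        = PLmk (of v) * PLmk (of (u - v)) * (PLmk (of (-u)) *
          PLmk (of u)) * PLmk (of (r - u)) * PLmk (of (-r)) := by simp only [mul_assoc]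
      _ = PLmk (of v) * (PLmk (of (u - v)) * PLmk (of (r - u))) * PLmk (of (-r)) := by
          rw [pl_neg_cancel, mul_one]; simp only [mul_assoc]
      _ = _ := by rw [pl_pair _ _ hd]; congr 4; abel
  · rw [Con.ker_rel]
    obtain ⟨x, a, b, rfl, rfl⟩ := (dep_iff _ _).1 h
    simp only [lift_eval_of, tri, map_one]
    rw [pl_pair _ _ ((dep_iff _ _).2 ⟨x, a, b - a, rfl, by module⟩), add_sub_cancel,
      pl_cancel_neg]

/-- The homomorphism. -/
def loopF : LoopGrp V →* PL0 V := Con.lift _ (FreeMonoid.lift tri) tri_le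

theorem loopF_of (p : V × V) : loopF (Loopmk (of p)) = tri p := by
  rw [loopF, Con.lift_mk', lift_eval_of]

/-- One step of the action on `V × LoopGrp V`. -/
def step (w : V) : (Function.End (V × LoopGrp V))ᵐᵒᵖ :=
  MulOpposite.op fun x => (x.1 + w, x.2 * Loopmk (of (x.1, x.1 + w)))

theorem step_le : conGen (PLRel V) ≤ Con.ker (FreeMonoid.lift (step (V := V))) := by
  refine Con.conGen_le.2 ?_
  rintro _ _ (⟨v, w, h⟩ | _)
  · rw [Con.ker_rel]
    simp only [map_mul, lift_eval_of]
    apply MulOpposite.unop_injective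
    funext ⟨p, g⟩
    obtain ⟨x, a, b, rfl, rfl⟩ := (dep_iff _ _).1 h
    have hc : Collinear ℝ ({p, p + a • x, p + (a • x + b • x)} : Set V) := by
      refine (collinear_iff_of_mem (p₀ := p) (by simp)).2 ⟨x, ?_⟩
      rintro q (rfl | rfl | rfl)
      · exact ⟨0, by simp⟩
      · exact ⟨a, by simp [add_comm]⟩
      · exact ⟨a + b, by simp only [vadd_eq_add]; module⟩
    change (p + a • x + b • x, g * Loopmk (of (p, p + a • x)) *
      Loopmk (of (p + a • x, p + a • x + b • x))) =
      (p + (a • x + b • x), g * Loopmk (of (p, p + (a • x + b • x))))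
    rw [add_assoc, mul_assoc, loop_comp _ _ _ hc]
  · rw [Con.ker_rel]
    simp only [lift_eval_of, map_one]
    apply MulOpposite.unop_injective
    funext ⟨p, g⟩
    change (p + 0, g * Loopmk (of (p, p + 0))) = (p, g)
    rw [add_zero, loop_triv _ _ ((dep_iff _ _).2 ⟨p, 1, 1, by simp, by simp⟩), mul_one]

/-- The action of `PL0 V`. -/
def act : PL0 V →* (Function.End (V × LoopGrp V))ᵐᵒᵖ :=
  Con.lift _ (FreeMonoid.lift step) step_le

theorem act_of (v : V) : act (PLmk (of v)) = step v := by
  rw [act, Con.lift_mk', lift_eval_of]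

theorem act_tri (p : V × V) (g : LoopGrp V) :
    (act (tri p)).unop (0, g) = (0, g * Loopmk (of p)) := by
  obtain ⟨v, u⟩ := p
  simp only [tri, map_mul, act_of]
  change (0 + v + (u - v) + -u, g * Loopmk (of (0, 0 + v)) *
    Loopmk (of (0 + v, 0 + v + (u - v))) *
    Loopmk (of (0 + v + (u - v), 0 + v + (u - v) + -u))) = _
  rw [zero_add, add_sub_cancel, add_neg_cancel,
    loop_triv 0 v ((dep_iff _ _).2 ⟨v, 0, 1, by simp, by simp⟩),
    loop_triv u 0 ((dep_iff _ _).2 ⟨u, 1, 0, by simp, by simp⟩), mul_one, mul_one]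

theorem act_F (w : FreeMonoid (V × V)) (g : LoopGrp V) :
    (act (loopF (Loopmk w))).unop (0, g) = (0, g * Loopmk w) := by
  induction w using FreeMonoid.inductionOn' generalizing g with
  | one => simp only [map_one, mul_one]; rfl
  | of_mul a w ih =>
    simp only [map_mul]
    change (act (loopF (Loopmk w))).unop ((act (loopF (Loopmk (of a)))).unop (0, g)) = _
    rw [loopF_of, act_tri, ih, mul_assoc]

theorem loopF_inj : Function.Injective (loopF (V := V)) := by
  intro x y h
  obtain ⟨x, rfl⟩ := Con.mk'_surjective x
  obtain ⟨y, rfl⟩ := Con.mk'_surjective y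
  have hx := act_F x 1
  have hy := act_F y 1
  rw [one_mul] at hx hy
  have h2 := hx.symm.trans ((congrArg (fun z => (act z).unop (0, 1)) h).trans hy)
  exact (Prod.ext_iff.1 h2).2

theorem range_sub (w : FreeMonoid (V × V)) :
    ∃ l : List V, l.sum = 0 ∧ PLmk (FreeMonoid.ofList l) = loopF (Loopmk w) := by
  induction w using FreeMonoid.inductionOn' with
  | one => exact ⟨[], rfl, by simp only [map_one, ofList_nil]⟩
  | of_mul a w ih =>
    obtain ⟨l, hl, h⟩ := ih
    refine ⟨[a.1, a.2 - a.1, -a.2] ++ l, by simp [hl]; abel, ?_⟩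
    rw [ofList_append, map_mul, map_mul, map_mul, h, loopF_of]
    congr 1

theorem sub_range (l : List V) (p : V) : ∃ g : LoopGrp V,
    PLmk (of p) * PLmk (FreeMonoid.ofList l) = loopF g * PLmk (of (p + l.sum)) := by
  induction l generalizing p with
  | nil => exact ⟨1, by simp only [ofList_nil, map_one, mul_one, one_mul, List.sum_nil, add_zero]⟩
  | cons a l ih =>
    obtain ⟨g, hg⟩ := ih (p + a)
    refine ⟨Loopmk (of (p, p + a)) * g, ?_⟩
    rw [map_mul, mul_assoc, List.sum_cons, ← add_assoc, ← hg, loopF_of, ofList_cons, map_mul]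
    simp only [tri, add_sub_cancel_left, mul_assoc]
    rw [← mul_assoc (PLmk (of (-(p + a)))), pl_neg_cancel, one_mul]

/-- `Loop(V) ≅ PL₀ᶜˡ(V)`, implemented as: there is a homomorphism sending the
generator `(v,u)` to the triangular loop `(v, u−v, −u)`, which is injective and has
image exactly the closed loops (elements represented by words summing to `0`). -/
theorem loopGrp_iso_closed_PL0 [FiniteDimensional ℝ V] :
    ∃ F : LoopGrp V →* PL0 V,
      (∀ v u : V, F (Loopmk (of (v, u))) =
          PLmk (of v * of (u - v) * of (-u))) ∧
      Function.Injective F ∧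
      Set.range F = {x : PL0 V | ∃ l : List V, l.sum = 0 ∧ PLmk (FreeMonoid.ofList l) = x} := by
  refine ⟨loopF, fun v u => ?_, loopF_inj, Set.ext fun x => ⟨?_, ?_⟩⟩
  · rw [loopF_of, map_mul, map_mul]; rfl
  · rintro ⟨g, rfl⟩
    obtain ⟨w, rfl⟩ := Con.mk'_surjective g
    exact range_sub w
  · rintro ⟨l, hl, rfl⟩
    obtain ⟨g, hg⟩ := sub_range l 0
    rw [hl, add_zero, pl_zero, one_mul, mul_one] at hg
    exact ⟨g, hg.symm⟩
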